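/- Let 0 < α < ω₁ and let E be a subset of the α'th functionally multiplicative class of a topological space X. Then E is K_α-embedded in X (every function f ∈ K_α(E) extends to a function g ∈ K_α(X)) if and only if E is α-embedded in X. -/

import Mathlib

open Set

universe u v

/-- `A` is functionally open in `X`: `A = f⁻¹((0,1])` for some continuous `f : X → [0,1]`. -/
def FunctionallyOpen (X : Type u) [TopologicalSpace X] (A : Set X) : Prop :=
  ∃ f : X → ℝ, Continuous f ∧ (∀ x, f x ∈ Set.Icc (0:ℝ) 1) ∧ A = f ⁻¹' (Set.Ioc 0 1)

/-- `A` is functionally closed in `X`: `A = f⁻¹(0)` for some continuous `f : X → [0,1]`. -/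
def FunctionallyClosed (X : Type u) [TopologicalSpace X] (A : Set X) : Prop :=
  ∃ f : X → ℝ, Continuous f ∧ (∀ x, f x ∈ Set.Icc (0:ℝ) 1) ∧ A = f ⁻¹' {0}

mutual
/-- The `α`'th functionally additive class in `X`. -/
inductive FunAdd (X : Type u) [TopologicalSpace X] : Ordinal.{0} → Set X → Prop where
  | base (A : Set X) : FunctionallyOpen X A → FunAdd X 0 A
  | union (α : Ordinal.{0}) (hα : α ≠ 0) (β : ℕ → Ordinal.{0}) (hβ : ∀ n, β n < α)
      (s : ℕ → Set X) (hs : ∀ n, FunMul X (β n) (s n)) : FunAdd X α (⋃ n, s n)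

/-- The `α`'th functionally multiplicative class in `X`. -/
inductive FunMul (X : Type u) [TopologicalSpace X] : Ordinal.{0} → Set X → Prop where
  | base (A : Set X) : FunctionallyClosed X A → FunMul X 0 A
  | inter (α : Ordinal.{0}) (hα : α ≠ 0) (β : ℕ → Ordinal.{0}) (hβ : ∀ n, β n < α)
      (s : ℕ → Set X) (hs : ∀ n, FunAdd X (β n) (s n)) : FunMul X α (⋂ n, s n)
end

mutual
/-- The `α`'th (ordinary) additive Borel class in `X`. -/
inductive BorelAdd (X : Type u) [TopologicalSpace X] : Ordinal.{0} → Set X → Prop where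
  | base (A : Set X) : IsOpen A → BorelAdd X 0 A
  | union (α : Ordinal.{0}) (hα : α ≠ 0) (β : ℕ → Ordinal.{0}) (hβ : ∀ n, β n < α)
      (s : ℕ → Set X) (hs : ∀ n, BorelMul X (β n) (s n)) : BorelAdd X α (⋃ n, s n)

/-- The `α`'th (ordinary) multiplicative Borel class in `X`. -/
inductive BorelMul (X : Type u) [TopologicalSpace X] : Ordinal.{0} → Set X → Prop where
  | base (A : Set X) : IsClosed A → BorelMul X 0 A
  | inter (α : Ordinal.{0}) (hα : α ≠ 0) (β : ℕ → Ordinal.{0}) (hβ : ∀ n, β n < α)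
      (s : ℕ → Set X) (hs : ∀ n, BorelAdd X (β n) (s n)) : BorelMul X α (⋂ n, s n)
end

/-- A set is functionally ambiguous of class `α` if it belongs to both the `α`'th functionally
additive and the `α`'th functionally multiplicative class. -/
def FunAmbiguous (X : Type u) [TopologicalSpace X] (α : Ordinal.{0}) (A : Set X) : Prop :=
  FunAdd X α A ∧ FunMul X α A

/-- `f ∈ K_α(X,Y)`: for `α = 0` continuity, for `α > 0` preimages of open sets belong to
the `α`'th functionally additive class. -/
def KClass {X : Type u} {Y : Type v} [TopologicalSpace X] [TopologicalSpace Y]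
    (α : Ordinal.{0}) (f : X → Y) : Prop :=
  (α = 0 → Continuous f) ∧ (α ≠ 0 → ∀ V : Set Y, IsOpen V → FunAdd X α (f ⁻¹' V))

/-- `A` and `B` are `α`-separated in `X`. -/
def AlphaSeparated {X : Type u} [TopologicalSpace X] (α : Ordinal.{0}) (A B : Set X) : Prop :=
  ∃ f : X → ℝ, KClass α f ∧ A ⊆ f ⁻¹' {0} ∧ B ⊆ f ⁻¹' {1}

/-- `X` is an `α`-separated space: any two disjoint sets of the `α`'th (ordinary)
multiplicative class are `α`-separated. -/
def AlphaSeparatedSpace (X : Type u) [TopologicalSpace X] (α : Ordinal.{0}) : Prop :=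
  ∀ A B : Set X, BorelMul X α A → BorelMul X α B → Disjoint A B → AlphaSeparated α A B

/-- `E` is `α`-embedded in `X`. -/
def AlphaEmbedded {X : Type u} [TopologicalSpace X] (α : Ordinal.{0}) (E : Set X) : Prop :=
  (∀ A : Set ↥E, FunAdd ↥E α A → ∃ B : Set X, FunAdd X α B ∧ Subtype.val '' A = B ∩ E) ∧
  (∀ A : Set ↥E, FunMul ↥E α A → ∃ B : Set X, FunMul X α B ∧ Subtype.val '' A = B ∩ E)

/-- `E` is ambiguously `α`-embedded in `X`. -/
def AmbiguouslyEmbedded {X : Type u} [TopologicalSpace X] (α : Ordinal.{0}) (E : Set X) : Prop :=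
  ∀ A : Set ↥E, FunAmbiguous ↥E α A →
    ∃ B : Set X, FunAmbiguous X α B ∧ Subtype.val '' A = B ∩ E

/-- The first uncountable ordinal. -/
noncomputable def omega1 : Ordinal.{0} := (Cardinal.aleph 1).ord

/-- `A` is an `F_σ`-set: a countable union of closed sets. -/
def IsFSigma {X : Type u} [TopologicalSpace X] (A : Set X) : Prop :=
  ∃ F : ℕ → Set X, (∀ n, IsClosed (F n)) ∧ A = ⋃ n, F n

/-- A space has a countable π-base. -/
def CountablePiBase (Z : Type v) [TopologicalSpace Z] : Prop :=
  ∃ 𝒰 : Set (Set Z), 𝒰.Countable ∧ (∀ U ∈ 𝒰, IsOpen U ∧ U.Nonempty) ∧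
    ∀ V : Set Z, IsOpen V → V.Nonempty → ∃ U ∈ 𝒰, U ⊆ V


section Aux

variable {X : Type u} [TopologicalSpace X]

lemma FunAdd.inv {α : Ordinal.{0}} {A : Set X} (h : FunAdd X α A) (hα : α ≠ 0) :
    ∃ (β : ℕ → Ordinal.{0}) (s : ℕ → Set X), (∀ n, β n < α) ∧ (∀ n, FunMul X (β n) (s n)) ∧
      A = ⋃ n, s n := by
  cases h with
  | base _ _ => exact absurd rfl hα
  | union _ _ β hβ s hs => exact ⟨β, s, hβ, hs, rfl⟩

lemma FunMul.inv {α : Ordinal.{0}} {A : Set X} (h : FunMul X α A) (hα : α ≠ 0) :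
    ∃ (β : ℕ → Ordinal.{0}) (s : ℕ → Set X), (∀ n, β n < α) ∧ (∀ n, FunAdd X (β n) (s n)) ∧
      A = ⋂ n, s n := by
  cases h with
  | base _ _ => exact absurd rfl hα
  | inter _ _ β hβ s hs => exact ⟨β, s, hβ, hs, rfl⟩

lemma FunAdd.inv0 {A : Set X} (h : FunAdd X 0 A) : FunctionallyOpen X A := by
  cases h with
  | base _ h => exact h
  | union _ h _ _ _ _ => exact absurd rfl h

lemma FunMul.inv0 {A : Set X} (h : FunMul X 0 A) : FunctionallyClosed X A := by
  cases h with
  | base _ h => exact h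
  | inter _ h _ _ _ _ => exact absurd rfl h

lemma fun_compl (α : Ordinal.{0}) : ∀ A : Set X,
    (FunAdd X α A → FunMul X α Aᶜ) ∧ (FunMul X α A → FunAdd X α Aᶜ) := by
  induction α using WellFoundedLT.induction with
  | _ α ih =>
  intro A
  by_cases hα : α = 0
  · subst hα
    constructor
    · intro h
      obtain ⟨f, hf, h01, rfl⟩ := h.inv0
      refine FunMul.base _ ⟨f, hf, h01, ?_⟩
      ext x
      have := h01 x
      simp only [mem_compl_iff, mem_preimage, mem_Ioc, mem_singleton_iff, mem_Icc] at *
      constructor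
      · intro h
        by_contra h'
        exact h ⟨lt_of_le_of_ne this.1 (Ne.symm h'), this.2⟩
      · intro h h'
        linarith [h'.1]
    · intro h
      obtain ⟨f, hf, h01, rfl⟩ := h.inv0
      refine FunAdd.base _ ⟨f, hf, h01, ?_⟩
      ext x
      have := h01 x
      simp only [mem_compl_iff, mem_preimage, mem_Ioc, mem_singleton_iff, mem_Icc] at *
      constructor
      · intro h
        exact ⟨lt_of_le_of_ne this.1 (Ne.symm h), this.2⟩
      · intro h h'
        linarith [h.1]
  · constructor
    · intro h
      obtain ⟨β, s, hβ, hs, rfl⟩ := h.inv hα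
      rw [compl_iUnion]
      exact FunMul.inter α hα β hβ _ fun n => (ih _ (hβ n) _).2 (hs n)
    · intro h
      obtain ⟨β, s, hβ, hs, rfl⟩ := h.inv hα
      rw [compl_iInter]
      exact FunAdd.union α hα β hβ _ fun n => (ih _ (hβ n) _).1 (hs n)

lemma FunAdd.compl {α : Ordinal.{0}} {A : Set X} (h : FunAdd X α A) : FunMul X α Aᶜ :=
  (fun_compl α A).1 h

lemma FunMul.compl {α : Ordinal.{0}} {A : Set X} (h : FunMul X α A) : FunAdd X α Aᶜ :=
  (fun_compl α A).2 h

lemma FunMul.toAdd {β α : Ordinal.{0}} {A : Set X} (h : FunMul X β A) (hβ : β < α) :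
    FunAdd X α A := by
  have := FunAdd.union α (ne_bot_of_gt hβ) (fun _ => β) (fun _ => hβ) (fun _ => A) (fun _ => h)
  rwa [iUnion_const] at this

lemma FunAdd.mono {β α : Ordinal.{0}} {A : Set X} (h : FunAdd X β A) (hβ : β ≤ α) :
    FunAdd X α A := by
  rcases hβ.eq_or_lt with rfl | hlt
  · exact h
  by_cases h0 : β = 0
  · subst h0
    obtain ⟨f, hf, h01, rfl⟩ := h.inv0
    have key : f ⁻¹' Ioc 0 1 = ⋃ n : ℕ, (fun x => max (1 / ((n : ℝ) + 1) - f x) 0) ⁻¹' {0} := by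
      ext x
      simp only [mem_preimage, mem_Ioc, mem_iUnion, mem_singleton_iff, max_eq_right_iff]
      constructor
      · rintro ⟨h, -⟩
        obtain ⟨n, hn⟩ := exists_nat_one_div_lt h
        exact ⟨n, by linarith⟩
      · rintro ⟨n, hn⟩
        have : (0:ℝ) < 1 / ((n : ℝ) + 1) := Nat.one_div_pos_of_nat
        exact ⟨by linarith, (h01 x).2⟩
    rw [key]
    refine FunAdd.union α hlt.ne' (fun _ => 0) (fun _ => hlt) _ fun n => FunMul.base _
      ⟨_, by fun_prop, fun x => ⟨le_max_right _ _, max_le ?_ zero_le_one⟩, rfl⟩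
    have h1 : 1 / ((n : ℝ) + 1) ≤ 1 := by
      rw [div_le_one (by positivity)]
      have : (0:ℝ) ≤ n := n.cast_nonneg
      linarith
    linarith [(h01 x).1]
  · obtain ⟨β', s, hβ', hs, rfl⟩ := h.inv h0
    exact FunAdd.union α (ne_bot_of_gt hlt) β' (fun n => (hβ' n).trans hlt) s hs

lemma FunMul.mono {β α : Ordinal.{0}} {A : Set X} (h : FunMul X β A) (hβ : β ≤ α) :
    FunMul X α A := by
  have := (h.compl.mono hβ).compl
  rwa [compl_compl] at this

lemma funAdd_empty {α : Ordinal.{0}} : FunAdd X α (∅ : Set X) := by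
  refine FunAdd.mono (β := 0) (FunAdd.base _ ⟨fun _ => 0, continuous_const, fun _ => by simp, ?_⟩)
    zero_le
  ext x; simp

lemma funAdd_univ {α : Ordinal.{0}} : FunAdd X α (univ : Set X) := by
  refine FunAdd.mono (β := 0) (FunAdd.base _ ⟨fun _ => 1, continuous_const, fun _ => by simp, ?_⟩)
    zero_le
  ext x; simp

lemma funAdd_iUnion {ι : Type*} [Countable ι] {α : Ordinal.{0}} (hα : α ≠ 0) {s : ι → Set X}
    (hs : ∀ i, FunAdd X α (s i)) : FunAdd X α (⋃ i, s i) := by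
  rcases isEmpty_or_nonempty ι with h | h
  · rw [iUnion_of_empty]; exact funAdd_empty
  obtain ⟨e, he⟩ := exists_surjective_nat ι
  choose β t hβ ht hst using fun i => (hs i).inv hα
  have : (⋃ i, s i) = ⋃ n : ℕ, t (e n.unpair.1) n.unpair.2 := by
    ext x
    simp only [mem_iUnion, hst]
    constructor
    · rintro ⟨i, j, h⟩
      obtain ⟨k, rfl⟩ := he i
      exact ⟨Nat.pair k j, by simpa using h⟩
    · rintro ⟨n, h⟩
      exact ⟨_, _, h⟩
  rw [this]
  exact FunAdd.union α hα (fun n => β (e n.unpair.1) n.unpair.2) (fun n => hβ _ _) _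
    fun n => ht _ _

lemma FunAdd.union2 {α : Ordinal.{0}} (hα : α ≠ 0) {A B : Set X} (hA : FunAdd X α A)
    (hB : FunAdd X α B) : FunAdd X α (A ∪ B) := by
  rw [union_eq_iUnion]
  exact funAdd_iUnion hα fun b => by cases b <;> assumption

lemma FunMul.inter2 {α : Ordinal.{0}} {A B : Set X} (hA : FunMul X α A)
    (hB : FunMul X α B) : FunMul X α (A ∩ B) := by
  by_cases hα : α = 0
  · subst hα
    obtain ⟨f, hf, hf01, rfl⟩ := hA.inv0
    obtain ⟨g, hg, hg01, rfl⟩ := hB.inv0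
    refine FunMul.base _ ⟨fun x => max (f x) (g x), hf.max hg, fun x =>
      ⟨le_max_of_le_left (hf01 x).1, max_le (hf01 x).2 (hg01 x).2⟩, ?_⟩
    ext x
    simp only [mem_inter_iff, mem_preimage, mem_singleton_iff]
    constructor
    · rintro ⟨h, h'⟩; simp [h, h']
    · intro h
      have h1 := le_max_left (f x) (g x)
      have h2 := le_max_right (f x) (g x)
      exact ⟨le_antisymm (by linarith) (hf01 x).1, le_antisymm (by linarith) (hg01 x).1⟩
  · have := (hA.compl.union2 hα hB.compl).compl
    rwa [compl_union, compl_compl, compl_compl] at this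

lemma FunAdd.inter2 {α : Ordinal.{0}} (hα : α ≠ 0) {A B : Set X} (hA : FunAdd X α A)
    (hB : FunAdd X α B) : FunAdd X α (A ∩ B) := by
  obtain ⟨β, s, hβ, hs, rfl⟩ := hA.inv hα
  obtain ⟨γ, t, hγ, ht, rfl⟩ := hB.inv hα
  rw [iUnion_inter]
  refine funAdd_iUnion hα fun i => ?_
  rw [inter_iUnion]
  refine funAdd_iUnion hα fun j => ?_
  exact FunMul.toAdd (((hs i).mono (le_max_left _ _)).inter2 ((ht j).mono (le_max_right _ _)))
    (max_lt (hβ i) (hγ j))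

/-- finite initial intersections of complements -/
lemma funAdd_forall_notMem {α : Ordinal.{0}} (hα : α ≠ 0) {s : ℕ → Set X}
    (hs : ∀ n, FunAdd X α (s n)ᶜ) (N : ℕ) : FunAdd X α {x | ∀ n < N, x ∉ s n} := by
  induction N with
  | zero => simpa using funAdd_univ
  | succ N ih =>
    have : {x | ∀ n < N + 1, x ∉ s n} = {x | ∀ n < N, x ∉ s n} ∩ (s N)ᶜ := by
      ext x
      simp only [mem_setOf_eq, mem_inter_iff, mem_compl_iff, Nat.lt_succ_iff_lt_or_eq]
      constructor
      · intro h
        exact ⟨fun n hn => h n (Or.inl hn), h N (Or.inr rfl)⟩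
      · rintro ⟨h, h'⟩ n (hn | rfl)
        · exact h n hn
        · exact h'
    rw [this]
    exact ih.inter2 hα (hs N)

lemma funAdd_first {α : Ordinal.{0}} (hα : α ≠ 0) {s : ℕ → Set X}
    (hs' : ∀ n, FunAdd X α (s n))
    (hs : ∀ n, FunAdd X α (s n)ᶜ) (N : ℕ) : FunAdd X α {x | x ∈ s N ∧ ∀ n < N, x ∉ s n} :=
  (hs' N).inter2 hα (funAdd_forall_notMem hα hs N)

lemma funAdd_iUnion_if {ι : Type*} [Countable ι] {α : Ordinal.{0}} (hα : α ≠ 0) {s : ι → Set X}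
    (p : ι → Prop) (hs : ∀ i, FunAdd X α (s i)) : FunAdd X α {x | ∃ i, p i ∧ x ∈ s i} := by
  have : {x | ∃ i, p i ∧ x ∈ s i} = ⋃ i : {i // p i}, s i := by
    ext x; simp
  rw [this]
  exact funAdd_iUnion hα fun i => hs i

lemma exists_select {ι : Type*} [Countable ι] {α : Ordinal.{0}} (hα : α ≠ 0)
    {S : ι → Set X} (hS : ∀ i, FunAdd X α (S i)) (hcov : ∀ x, ∃ i, x ∈ S i) :
    ∃ g : X → ι, (∀ x, x ∈ S (g x)) ∧ ∀ i, FunAdd X α (g ⁻¹' {i}) := by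
  classical
  rcases isEmpty_or_nonempty ι with h | h
  · exact ⟨fun x => (hcov x).choose, fun x => (hcov x).choose_spec, fun i => h.elim i⟩
  obtain ⟨e, he⟩ := exists_surjective_nat ι
  choose β t hβ ht hst using fun i => (hS i).inv hα
  set T : ℕ → Set X := fun n => t (e n.unpair.1) n.unpair.2 with hT
  have hTA : ∀ n, FunAdd X α (T n) := fun n => (ht _ _).toAdd (hβ _ _)
  have hTC : ∀ n, FunAdd X α (T n)ᶜ := fun n => (ht _ _).compl.mono (hβ _ _).le
  have hex : ∀ x, ∃ n, x ∈ T n := by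
    intro x
    obtain ⟨i, hi⟩ := hcov x
    rw [hst, mem_iUnion] at hi
    obtain ⟨j, hj⟩ := hi
    obtain ⟨k, rfl⟩ := he i
    exact ⟨Nat.pair k j, by simpa [hT] using hj⟩
  refine ⟨fun x => e (Nat.find (hex x)).unpair.1, fun x => ?_, fun i => ?_⟩
  · have := Nat.find_spec (hex x)
    rw [hst, mem_iUnion]
    exact ⟨_, this⟩
  · have := funAdd_iUnion_if hα (fun n => e (Nat.unpair n).1 = i)
      (fun n => funAdd_first hα hTA hTC n)
    convert this using 1
    ext x
    simp only [mem_preimage, mem_singleton_iff, mem_setOf_eq]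
    constructor
    · intro h
      exact ⟨_, h, Nat.find_spec (hex x), fun n hn => Nat.find_min (hex x) hn⟩
    · rintro ⟨n, hn, hx, hm⟩
      have : Nat.find (hex x) = n := by
        rw [Nat.find_eq_iff]; exact ⟨hx, hm⟩
      rw [this]; exact hn

lemma funAdd_preimage {ι : Type*} [Countable ι] {α : Ordinal.{0}} (hα : α ≠ 0)
    {g : X → ι} (hg : ∀ i, FunAdd X α (g ⁻¹' {i})) (p : ι → Prop) :
    FunAdd X α {x | p (g x)} := by
  have := funAdd_iUnion_if hα p hg
  convert this using 1
  ext x; simp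

/-- Every additive set is the cozero set of a function of class `K_α`. -/
lemma exists_kclass {α : Ordinal.{0}} (hα : α ≠ 0) {A : Set X} (hA : FunAdd X α A) :
    ∃ f : X → ℝ, KClass α f ∧ A = f ⁻¹' {0}ᶜ := by
  classical
  obtain ⟨β, s, hβ, hs, rfl⟩ := hA.inv hα
  have hA : ∀ n, FunAdd X α (s n) := fun n => (hs _).toAdd (hβ _)
  have hC : ∀ n, FunAdd X α (s n)ᶜ := fun n => (hs _).compl.mono (hβ _).le
  let f : X → ℝ := fun x => if h : ∃ n, x ∈ s n then 1 / ((Nat.find h : ℝ) + 1) else 0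
  have hf1 : ∀ n x, x ∈ s n → (∀ m < n, x ∉ s m) → f x = 1 / ((n : ℝ) + 1) := by
    intro n x hx hm
    have h : ∃ n, x ∈ s n := ⟨n, hx⟩
    have : Nat.find h = n := by
      rw [Nat.find_eq_iff]; exact ⟨hx, hm⟩
    simp only [f, dif_pos h, this]
  have hf0 : ∀ x, (¬ ∃ n, x ∈ s n) → f x = 0 := fun x hx => dif_neg hx
  have hmin : ∀ x, (∃ n, x ∈ s n) → ∃ n, x ∈ s n ∧ ∀ m < n, x ∉ s m := fun x h =>
    ⟨Nat.find h, Nat.find_spec h, fun m hm => Nat.find_min h hm⟩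
  refine ⟨f, ⟨fun h => absurd h hα, fun _ V hV => ?_⟩, ?_⟩
  · have h1 := funAdd_iUnion_if hα (fun n : ℕ => 1 / ((n : ℝ) + 1) ∈ V)
      (fun n => funAdd_first hα hA hC n)
    by_cases h0 : (0 : ℝ) ∈ V
    · have hlim := tendsto_one_div_add_atTop_nhds_zero_nat (𝕜 := ℝ)
      obtain ⟨N, hN⟩ := Filter.eventually_atTop.1 (hlim (hV.mem_nhds h0))
      have h2 := (funAdd_forall_notMem hα hC N).union2 hα h1
      convert h2 using 1
      ext x
      simp only [mem_preimage, mem_union, mem_setOf_eq]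
      by_cases hx : ∃ n, x ∈ s n
      · obtain ⟨n, hn, hm⟩ := hmin x hx
        constructor
        · intro h
          rw [hf1 n x hn hm] at h
          exact Or.inr ⟨n, h, hn, hm⟩
        · rintro (h | ⟨k, hk, hk1, hk2⟩)
          · rw [hf1 n x hn hm]
            exact hN n (not_lt.1 fun hlt => h n hlt hn)
          · rw [hf1 k x hk1 hk2]; exact hk
      · rw [hf0 x hx]
        refine ⟨fun _ => Or.inl fun n _ hn => hx ⟨n, hn⟩, fun _ => h0⟩
    · convert h1 using 1
      ext x
      simp only [mem_preimage, mem_setOf_eq]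
      constructor
      · intro h
        by_cases hx : ∃ n, x ∈ s n
        · obtain ⟨n, hn, hm⟩ := hmin x hx
          rw [hf1 n x hn hm] at h
          exact ⟨n, h, hn, hm⟩
        · rw [hf0 x hx] at h
          exact absurd h h0
      · rintro ⟨k, hk, hk1, hk2⟩
        rw [hf1 k x hk1 hk2]; exact hk
  · ext x
    simp only [mem_iUnion, mem_preimage, mem_compl_iff, mem_singleton_iff]
    constructor
    · intro hx
      obtain ⟨n, hn, hm⟩ := hmin x hx
      rw [hf1 n x hn hm]
      exact Nat.one_div_pos_of_nat.ne'
    · intro h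
      by_contra hx
      exact h (hf0 x hx)

lemma extend_aux {α : Ordinal.{0}} (hα : α ≠ 0) {E : Set X} (f : E → ℝ)
    (hF : ∀ V : Set ℝ, IsOpen V → FunAdd X α {x | ∀ h : x ∈ E, f ⟨x, h⟩ ∈ V}) :
    ∃ g : X → ℝ, KClass α g ∧ ∀ x : E, g x = f x := by
  let e : ℕ → ℝ := fun n => (1 / 2) ^ n
  have he : ∀ n, 0 < e n := fun n => by positivity
  have hes : ∀ n, e (n + 1) = e n / 2 := fun n => by simp only [e, pow_succ]; ring
  have hFr : ∀ (r : ℚ) (n : ℕ), FunAdd X α {x | ∀ h : x ∈ E, |f ⟨x, h⟩ - r| < e n} := by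
    intro r n
    have := hF (Metric.ball (r : ℝ) (e n)) Metric.isOpen_ball
    simpa only [Metric.mem_ball, Real.dist_eq] using this
  let P : ℕ → (X → ℚ) → Prop := fun n g => (∀ q, FunAdd X α (g ⁻¹' {q})) ∧
    ∀ x, ∀ h : x ∈ E, |f ⟨x, h⟩ - g x| < e n
  have h0 : ∃ g, P 0 g := by
    obtain ⟨g, h1, h2⟩ := exists_select hα (fun r : ℚ => hFr r 0) (by
      intro x
      by_cases hx : x ∈ E
      · obtain ⟨r, hr⟩ := exists_rat_near (f ⟨x, hx⟩) (he 0)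
        exact ⟨r, fun _ => hr⟩
      · exact ⟨0, fun h => absurd h hx⟩)
    exact ⟨g, h2, fun x h => h1 x h⟩
  have hstep : ∀ n (g : X → ℚ), P n g → ∃ g' : X → ℚ, P (n + 1) g' ∧
      ∀ x, |(g x : ℝ) - g' x| < 2 * e n := by
    intro n g hg
    obtain ⟨g', h1, h2⟩ := exists_select hα (S := fun r : ℚ =>
        {x | ∀ h : x ∈ E, |f ⟨x, h⟩ - r| < e (n + 1)} ∩ {x | |(g x : ℝ) - r| < 2 * e n})
      (fun r : ℚ => (hFr r (n + 1)).inter2 hα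
        (funAdd_preimage hα hg.1 (fun q : ℚ => |(q : ℝ) - r| < 2 * e n))) (by
      intro x
      have hen := he n
      by_cases hx : x ∈ E
      · obtain ⟨r, hr⟩ := exists_rat_near (f ⟨x, hx⟩) (he (n + 1))
        refine ⟨r, fun _ => hr, ?_⟩
        have h3 := hg.2 x hx
        rw [hes] at hr
        simp only [mem_setOf_eq]
        rw [abs_lt] at *
        constructor <;> linarith [h3.1, h3.2, hr.1, hr.2]
      · refine ⟨g x, fun h => absurd h hx, ?_⟩
        simpa using hen)
    exact ⟨g', ⟨h2, fun x h => (h1 x).1 h⟩, fun x => (h1 x).2⟩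
  choose! nxt hn1 hn2 using hstep
  obtain ⟨g0, hg0⟩ := h0
  obtain ⟨G, hG0, hGs⟩ : ∃ G : ℕ → X → ℚ, G 0 = g0 ∧ ∀ n, G (n + 1) = nxt n (G n) :=
    ⟨fun n => Nat.rec g0 (fun n g => nxt n g) n, rfl, fun _ => rfl⟩
  have hG : ∀ n, P n (G n) := by
    intro n
    induction n with
    | zero => rw [hG0]; exact hg0
    | succ n ih => rw [hGs]; exact hn1 n _ ih
  have hd : ∀ (x : X) (n : ℕ), dist ((G n x : ℚ) : ℝ) ((G (n + 1) x : ℚ) : ℝ) ≤ 4 / 2 / 2 ^ n := by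
    intro x n
    have := (hn2 n _ (hG n) x).le
    rw [Real.dist_eq, hGs]
    refine this.trans (le_of_eq ?_)
    simp only [e, one_div, inv_pow]
    ring
  have hlim : ∀ x, ∃ y, Filter.Tendsto (fun n => ((G n x : ℚ) : ℝ)) Filter.atTop (nhds y) := fun x =>
    cauchySeq_tendsto_of_complete (cauchySeq_of_le_geometric_two (hd x))
  choose g hg using hlim
  have hgd : ∀ (x : X) (n : ℕ), dist ((G n x : ℚ) : ℝ) (g x) ≤ 4 / 2 ^ n := fun x n =>
    dist_le_of_le_geometric_two_of_tendsto (hd x) (hg x) n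
  have hz : Filter.Tendsto e Filter.atTop (nhds 0) :=
    tendsto_pow_atTop_nhds_zero_of_lt_one (by norm_num) (by norm_num)
  refine ⟨g, ⟨fun h => absurd h hα, fun _ V hV => ?_⟩, fun x => ?_⟩
  · have := funAdd_iUnion hα fun n => funAdd_preimage hα (hG n).1
      (fun q : ℚ => Metric.closedBall (q : ℝ) (4 / 2 ^ n) ⊆ V)
    convert this using 1
    ext x
    simp only [mem_preimage, mem_iUnion, mem_setOf_eq]
    constructor
    · intro hx
      obtain ⟨δ, hδ, hb⟩ := Metric.isOpen_iff.1 hV _ hx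
      obtain ⟨n, hn⟩ := exists_pow_lt_of_lt_one (show 0 < δ / 8 by positivity)
        (show (1 / 2 : ℝ) < 1 by norm_num)
      refine ⟨n, fun y hy => hb ?_⟩
      rw [Metric.mem_closedBall] at hy
      rw [Metric.mem_ball]
      have h4 : (4 : ℝ) / 2 ^ n = 4 * (1 / 2) ^ n := by
        simp only [one_div, inv_pow]; ring
      have h1 := hgd x n
      have h2 := dist_triangle y ((G n x : ℚ) : ℝ) (g x)
      rw [h4] at hy h1
      linarith
    · rintro ⟨n, hn⟩
      apply hn
      rw [Metric.mem_closedBall, dist_comm]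
      exact hgd x n
  · refine tendsto_nhds_unique (hg x) ?_
    rw [tendsto_iff_dist_tendsto_zero]
    refine squeeze_zero (fun _ => dist_nonneg) (fun n => ?_) hz
    rw [dist_comm, Real.dist_eq]
    exact ((hG n).2 x x.2).le

end Aux

/-- a set of the `α`'th functionally multiplicative class is `K_α`-embedded
iff it is `α`-embedded. -/
theorem stmt13 {X : Type u} [TopologicalSpace X] (α : Ordinal.{0}) (hα0 : 0 < α)
    (hα : α < omega1) (E : Set X) (hEm : FunMul X α E) :
    (∀ f : ↥E → ℝ, KClass α f → ∃ g : X → ℝ, KClass α g ∧ ∀ x : ↥E, g ↑x = f x) ↔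
    AlphaEmbedded α E := by
  have hα' : α ≠ 0 := hα0.ne'
  constructor
  · intro hext
    have key : ∀ A : Set ↥E, FunAdd ↥E α A → ∃ B : Set X, FunAdd X α B ∧ A = Subtype.val ⁻¹' B := by
      intro A hA
      obtain ⟨f, hf, rfl⟩ := exists_kclass hα' hA
      obtain ⟨g, hg, hgf⟩ := hext f hf
      refine ⟨g ⁻¹' {0}ᶜ, hg.2 hα' _ isOpen_compl_singleton, ?_⟩
      ext x
      simp [hgf]
    constructor
    · intro A hA
      obtain ⟨B, hB, rfl⟩ := key A hA
      exact ⟨B, hB, by rw [Subtype.image_preimage_coe, inter_comm]⟩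
    · intro A hA
      obtain ⟨B, hB, h⟩ := key Aᶜ hA.compl
      refine ⟨Bᶜ, hB.compl, ?_⟩
      rw [← compl_compl A, h, ← preimage_compl, Subtype.image_preimage_coe, inter_comm]
  · rintro ⟨hemb, -⟩ f hf
    refine extend_aux hα' f fun V hV => ?_
    obtain ⟨B, hB, h⟩ := hemb _ (hf.2 hα' V hV)
    have := hB.union2 hα' hEm.compl
    convert this using 1
    ext x
    have hx : x ∈ Subtype.val '' (f ⁻¹' V) ↔ x ∈ B ∩ E := by rw [h]
    simp only [mem_image, mem_preimage, Subtype.exists, exists_and_right, exists_eq_right,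
      mem_inter_iff] at hx
    simp only [mem_setOf_eq, mem_union, mem_compl_iff]
    by_cases hE : x ∈ E
    · simp only [hE, exists_true_left, and_true] at hx
      simp [hE, hx]
    · simp [hE]
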